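/- Let α, M ≥ 1 be integers, η > 0, b_1, …, b_M ∈ ℝ^α, let Θ ⊆ ℝ^L be open, and let p_1, …, p_M : Θ → (0,1) be twice continuously differentiable with Σ_{j=1}^M p_j(θ) = 1 for all θ ∈ Θ. Define the parameterized mixture density f(z;θ) = Σ_{j=1}^M p_j(θ) (2πη²)^{−α/2} exp(−‖z−b_j‖²/(2η²)) on ℝ^α. Then for every θ ∈ Θ and all indices s, t ∈ {1,…,L}, the Fisher-information entry satisfies −∫_{ℝ^α} (∂²/∂θ_s∂θ_t) log f(z;θ) · f(z;θ) dz = −Σ_{j=1}^M [ ∂²p_j(θ)/∂θ_s∂θ_t − Σ_{i=1}^M (∂p_j(θ)/∂θ_s)(∂p_i(θ)/∂θ_t) Φ_{j,i}(θ) ], where Φ_{j,i}(θ) = ∫_{ℝ^α} (2πη²)^{−α/2} exp(−(‖z−b_j‖² + ‖z−b_i‖²)/(2η²)) / x(z;θ) dz and x(z;θ) = Σ_{v=1}^M p_v(θ) exp(−‖z−b_v‖²/(2η²)). (This is the per-sensor form of the transformed Fisher-information expression of Lemma 4.) -/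

import Mathlib

open MeasureTheory Real

/-- Partial derivative of `g : ℝ^L → ℝ` with respect to the `s`-th coordinate. -/
noncomputable def pd (L : ℕ) (s : Fin L) (g : (Fin L → ℝ) → ℝ) :
    (Fin L → ℝ) → ℝ :=
  fun θ => fderiv ℝ g θ (Pi.single s 1)

/-- `x(z;θ) = Σ_v p_v exp(−‖z−b_v‖²/(2η²))`. -/
noncomputable def xmix (α M : ℕ) (η : ℝ) (b : Fin M → EuclideanSpace ℝ (Fin α))
    (p : Fin M → ℝ) (z : EuclideanSpace ℝ (Fin α)) : ℝ :=
  ∑ v, p v * Real.exp (-‖z - b v‖ ^ 2 / (2 * η ^ 2))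

/-! ### Partial derivatives -/

lemma pd_congr {L : ℕ} {s : Fin L} {g h : (Fin L → ℝ) → ℝ} {θ : Fin L → ℝ}
    (hgh : g =ᶠ[nhds θ] h) : pd L s g θ = pd L s h θ := by
  simp only [pd, hgh.fderiv_eq]

lemma pd_sum_mul_const {L : ℕ} {ι : Type*} [Fintype ι] (s : Fin L)
    {p : ι → (Fin L → ℝ) → ℝ} {θ : Fin L → ℝ}
    (hp : ∀ j, DifferentiableAt ℝ (p j) θ) (w : ι → ℝ) :
    pd L s (fun θ' => ∑ j, p j θ' * w j) θ = ∑ j, pd L s (p j) θ * w j := by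
  have h : HasFDerivAt (fun θ' => ∑ j, p j θ' * w j) (∑ j, w j • fderiv ℝ (p j) θ) θ :=
    HasFDerivAt.fun_sum fun j _ => (hp j).hasFDerivAt.mul_const (w j)
  simp [pd, h.fderiv, mul_comm]

lemma differentiableAt_pd {L : ℕ} (t : Fin L) {g : (Fin L → ℝ) → ℝ} {θ : Fin L → ℝ}
    (hg : ContDiffAt ℝ 2 g θ) : DifferentiableAt ℝ (pd L t g) θ :=
  ((hg.fderiv_right (m := 1) (by norm_num)).differentiableAt (by norm_num)).clm_apply
    (differentiableAt_const _)

lemma eventually_differentiableAt {L : ℕ} {g : (Fin L → ℝ) → ℝ} {θ : Fin L → ℝ}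
    (hg : ContDiffAt ℝ 2 g θ) : ∀ᶠ θ' in nhds θ, DifferentiableAt ℝ g θ' :=
  (hg.eventually (by simp)).mono fun _ h => h.differentiableAt (by norm_num)

lemma pd_pd_sum_mul_const {L : ℕ} {ι : Type*} [Fintype ι] (s t : Fin L)
    {p : ι → (Fin L → ℝ) → ℝ} {θ : Fin L → ℝ}
    (hp : ∀ j, ContDiffAt ℝ 2 (p j) θ) (w : ι → ℝ) :
    pd L s (pd L t (fun θ' => ∑ j, p j θ' * w j)) θ =
      ∑ j, pd L s (pd L t (p j)) θ * w j := by
  have h : pd L t (fun θ' => ∑ j, p j θ' * w j) =ᶠ[nhds θ]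
      fun θ' => ∑ j, pd L t (p j) θ' * w j := by
    filter_upwards [Filter.eventually_all.2 fun j => eventually_differentiableAt (hp j)]
      with θ' h' using pd_sum_mul_const t h' w
  rw [pd_congr h, pd_sum_mul_const s (fun j => differentiableAt_pd t (hp j)) w]

lemma pd_pd_log_mul_self {L : ℕ} (s t : Fin L) {g : (Fin L → ℝ) → ℝ} {θ : Fin L → ℝ}
    (hg : ContDiffAt ℝ 2 g θ) (h0 : g θ ≠ 0) :
    pd L s (pd L t (fun θ' => Real.log (g θ'))) θ * g θ =
      pd L s (pd L t g) θ - pd L s g θ * pd L t g θ / g θ := by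
  have h : pd L t (fun θ' => Real.log (g θ')) =ᶠ[nhds θ] fun θ' => pd L t g θ' * (g θ')⁻¹ := by
    filter_upwards [eventually_differentiableAt hg, hg.continuousAt.eventually_ne h0]
      with θ' hd hne
    simp [pd, fderiv.log hd hne, mul_comm]
  have hd : DifferentiableAt ℝ g θ := hg.differentiableAt (by norm_num)
  have hq := (differentiableAt_pd t hg).hasFDerivAt.fun_mul
    ((hasDerivAt_inv h0).comp_hasFDerivAt θ hd.hasFDerivAt)
  simp only [Function.comp_apply] at hq
  rw [pd_congr h, pd, hq.fderiv]
  simp [pd]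
  field_simp
  ring

/-! ### Gaussian integrals and mixtures -/

section Gaussian

variable {V : Type*} [NormedAddCommGroup V] [InnerProductSpace ℝ V] [FiniteDimensional ℝ V]
  [MeasurableSpace V] [BorelSpace V]

lemma integral_exp_neg_norm_sub_sq_div {η : ℝ} (hη : 0 < η) (b : V) :
    ∫ z : V, Real.exp (-‖z - b‖ ^ 2 / (2 * η ^ 2)) =
      (2 * Real.pi * η ^ 2) ^ ((Module.finrank ℝ V : ℝ) / 2) := by
  rw [integral_sub_right_eq_self (fun z : V => Real.exp (-‖z‖ ^ 2 / (2 * η ^ 2))) b]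
  have h := GaussianFourier.integral_rexp_neg_mul_sq_norm (V := V)
    (b := 1 / (2 * η ^ 2)) (by positivity)
  rw [div_div_eq_mul_div, div_one] at h
  rw [show 2 * Real.pi * η ^ 2 = Real.pi * (2 * η ^ 2) by ring, ← h]
  refine integral_congr_ae (.of_forall fun z => congrArg Real.exp ?_)
  ring

lemma integrable_exp_neg_norm_sub_sq_div {η : ℝ} (hη : 0 < η) (b : V) :
    Integrable fun z : V => Real.exp (-‖z - b‖ ^ 2 / (2 * η ^ 2)) := by
  refine .of_integral_ne_zero ?_
  rw [integral_exp_neg_norm_sub_sq_div hη]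
  positivity

end Gaussian

lemma mul_exp_le_xmix {α M : ℕ} (η : ℝ) (b : Fin M → EuclideanSpace ℝ (Fin α))
    {p : Fin M → ℝ} (hp : ∀ j, 0 < p j) (j : Fin M) (z : EuclideanSpace ℝ (Fin α)) :
    p j * Real.exp (-‖z - b j‖ ^ 2 / (2 * η ^ 2)) ≤ xmix α M η b p z :=
  Finset.single_le_sum (f := fun v => p v * Real.exp (-‖z - b v‖ ^ 2 / (2 * η ^ 2)))
    (fun v _ => mul_nonneg (hp v).le (Real.exp_pos _).le) (Finset.mem_univ j)

lemma xmix_pos {α M : ℕ} (η : ℝ) (b : Fin M → EuclideanSpace ℝ (Fin α))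
    {p : Fin M → ℝ} (hp : ∀ j, 0 < p j) (j : Fin M) (z : EuclideanSpace ℝ (Fin α)) :
    0 < xmix α M η b p z :=
  (mul_pos (hp j) (Real.exp_pos _)).trans_le (mul_exp_le_xmix η b hp j z)

lemma integrable_exp_div_xmix {α M : ℕ} {η : ℝ} (hη : 0 < η)
    (b : Fin M → EuclideanSpace ℝ (Fin α)) {p : Fin M → ℝ} (hp : ∀ j, 0 < p j) (c : ℝ)
    (j i : Fin M) :
    Integrable fun z : EuclideanSpace ℝ (Fin α) =>
      (c * Real.exp (-(‖z - b j‖ ^ 2 + ‖z - b i‖ ^ 2) / (2 * η ^ 2))) / xmix α M η b p z := by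
  have hx : Continuous (xmix α M η b p) := by
    unfold xmix
    fun_prop
  refine ((integrable_exp_neg_norm_sub_sq_div hη (b i)).const_mul (|c| / p j)).mono'
    (Continuous.aestronglyMeasurable ?_) (.of_forall fun z => ?_)
  · exact Continuous.div (by fun_prop) hx fun z => (xmix_pos η b hp j z).ne'
  · have hxz := xmix_pos η b hp j z
    have hpj := hp j
    rw [norm_div, norm_mul, Real.norm_eq_abs, Real.norm_of_nonneg hxz.le,
      Real.norm_of_nonneg (Real.exp_pos _).le, div_le_iff₀ hxz, neg_add, add_div, Real.exp_add]
    calc |c| * (Real.exp (-‖z - b j‖ ^ 2 / (2 * η ^ 2)) * Real.exp (-‖z - b i‖ ^ 2 / (2 * η ^ 2)))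
        = |c| / p j * Real.exp (-‖z - b i‖ ^ 2 / (2 * η ^ 2)) *
            (p j * Real.exp (-‖z - b j‖ ^ 2 / (2 * η ^ 2))) := by
          field_simp
      _ ≤ _ := by
          gcongr
          exact mul_exp_le_xmix η b hp j z

theorem fisher_information_mixture_transformed
    (α M L : ℕ) (hα : 1 ≤ α) (hM : 1 ≤ M) (η : ℝ) (hη : 0 < η)
    (b : Fin M → EuclideanSpace ℝ (Fin α))
    (Θ : Set (Fin L → ℝ)) (hΘ : IsOpen Θ)
    (p : Fin M → (Fin L → ℝ) → ℝ)
    (hp01 : ∀ j, ∀ θ ∈ Θ, 0 < p j θ ∧ p j θ < 1)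
    (hpC2 : ∀ j, ContDiffOn ℝ 2 (p j) Θ)
    (hsum : ∀ θ ∈ Θ, ∑ j, p j θ = 1)
    (θ : Fin L → ℝ) (hθ : θ ∈ Θ) (s t : Fin L) :
    -∫ z : EuclideanSpace ℝ (Fin α),
        pd L s (fun θ' => pd L t (fun θ'' => Real.log
            (∑ j', p j' θ'' * (2 * Real.pi * η ^ 2) ^ (-(α : ℝ) / 2) *
              Real.exp (-‖z - b j'‖ ^ 2 / (2 * η ^ 2)))) θ') θ *
        (∑ j', p j' θ * (2 * Real.pi * η ^ 2) ^ (-(α : ℝ) / 2) *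
          Real.exp (-‖z - b j'‖ ^ 2 / (2 * η ^ 2))) =
      -∑ j', (pd L s (fun θ' => pd L t (p j') θ') θ
        - ∑ i', pd L s (p j') θ * pd L t (p i') θ *
            ∫ z : EuclideanSpace ℝ (Fin α),
              ((2 * Real.pi * η ^ 2) ^ (-(α : ℝ) / 2) *
                Real.exp (-(‖z - b j'‖ ^ 2 + ‖z - b i'‖ ^ 2) / (2 * η ^ 2))) /
              xmix α M η b (fun v => p v θ) z) := by
  have hp : ∀ j, ContDiffAt ℝ 2 (p j) θ := fun j => (hpC2 j).contDiffAt (hΘ.mem_nhds hθ)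
  have hpos : ∀ j, 0 < p j θ := fun j => (hp01 j θ hθ).1
  set c : ℝ := (2 * Real.pi * η ^ 2) ^ (-(α : ℝ) / 2) with hc
  have hc0 : 0 < c := by positivity
  have hgauss (j : Fin M) : ∫ z : EuclideanSpace ℝ (Fin α),
      c * Real.exp (-‖z - b j‖ ^ 2 / (2 * η ^ 2)) = 1 := by
    rw [integral_const_mul, integral_exp_neg_norm_sub_sq_div hη, hc, finrank_euclideanSpace_fin,
      ← Real.rpow_add (by positivity), neg_div, neg_add_cancel, Real.rpow_zero]
  have hintegrand (z : EuclideanSpace ℝ (Fin α)) :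
      pd L s (fun θ' => pd L t (fun θ'' => Real.log
          (∑ j', p j' θ'' * c * Real.exp (-‖z - b j'‖ ^ 2 / (2 * η ^ 2)))) θ') θ *
        (∑ j', p j' θ * c * Real.exp (-‖z - b j'‖ ^ 2 / (2 * η ^ 2))) =
      ∑ j, (pd L s (pd L t (p j)) θ * (c * Real.exp (-‖z - b j‖ ^ 2 / (2 * η ^ 2))) -
        ∑ i, pd L s (p j) θ * pd L t (p i) θ *
          ((c * Real.exp (-(‖z - b j‖ ^ 2 + ‖z - b i‖ ^ 2) / (2 * η ^ 2))) /
            xmix α M η b (fun v => p v θ) z)) := by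
    have hx := xmix_pos η b hpos ⟨0, hM⟩ z
    have hfx : ∑ j, p j θ * (c * Real.exp (-‖z - b j‖ ^ 2 / (2 * η ^ 2))) =
        c * xmix α M η b (fun v => p v θ) z := by
      rw [xmix, Finset.mul_sum]
      exact Finset.sum_congr rfl fun j _ => by ring
    have hd : ∀ j, DifferentiableAt ℝ (p j) θ := fun j => (hp j).differentiableAt (by norm_num)
    simp only [mul_assoc _ c]
    rw [pd_pd_log_mul_self s t (ContDiffAt.sum fun j _ => (hp j).mul contDiffAt_const)
      (by rw [hfx]; positivity), pd_pd_sum_mul_const s t hp, pd_sum_mul_const s hd,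
      pd_sum_mul_const t hd, hfx, Finset.sum_sub_distrib, Finset.sum_mul_sum, Finset.sum_div]
    congr 1
    refine Finset.sum_congr rfl fun j _ => ?_
    rw [Finset.sum_div]
    refine Finset.sum_congr rfl fun i _ => ?_
    rw [neg_add, add_div, Real.exp_add]
    field_simp
  have hint₁ (j : Fin M) : Integrable fun z : EuclideanSpace ℝ (Fin α) =>
      pd L s (pd L t (p j)) θ * (c * Real.exp (-‖z - b j‖ ^ 2 / (2 * η ^ 2))) :=
    ((integrable_exp_neg_norm_sub_sq_div hη (b j)).const_mul c).const_mul _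
  have hint₂ (j i : Fin M) : Integrable fun z : EuclideanSpace ℝ (Fin α) =>
      pd L s (p j) θ * pd L t (p i) θ *
        ((c * Real.exp (-(‖z - b j‖ ^ 2 + ‖z - b i‖ ^ 2) / (2 * η ^ 2))) /
          xmix α M η b (fun v => p v θ) z) :=
    (integrable_exp_div_xmix hη b hpos c j i).const_mul _
  simp only [hintegrand]
  rw [integral_finsetSum]
  swap
  · exact fun j _ => (hint₁ j).sub (integrable_finsetSum _ fun i _ => hint₂ j i)
  congr 1
  refine Finset.sum_congr rfl fun j _ => ?_
  rw [integral_sub (hint₁ j) (integrable_finsetSum _ fun i _ => hint₂ j i),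
    integral_finsetSum _ fun i _ => hint₂ j i, integral_const_mul, hgauss, mul_one]
  simp only [integral_const_mul (pd L s (p j) θ * _)]
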